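/- Let Γ = (V,E) and Γ' = (V',E') be finite simple graphs with families of nontrivial finite vertex groups (G_v)_{v∈V} and (G'_{v'})_{v'∈V'}, and suppose φ is a group isomorphism from the graph product G of (Γ, G_v) to the graph product G' of (Γ', G'_{v'}). Then for each clique C of Γ there exists a unique clique C' of Γ' such that φ(G(C)) is conjugate in G' to G'(C'). -/

import Mathlib

open Monoid

/-- The set of commutator relators defining a graph product. -/
def graphProdRels {V : Type*} (Γ : SimpleGraph V) (G : V → Type*) [∀ v, Group (G v)] :
    Set (CoprodI G) :=
  {x | ∃ (u v : V) (_ : Γ.Adj u v) (g : G u) (h : G v),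
    x = (CoprodI.of g)⁻¹ * (CoprodI.of h)⁻¹ * CoprodI.of g * CoprodI.of h}

/-- The graph product of the graph of groups `(Γ, G)`: the quotient of the free product of the
vertex groups by the normal closure of the commutators of elements of pairs of adjacent vertex
groups. -/
def GraphProduct {V : Type*} (Γ : SimpleGraph V) (G : V → Type*) [∀ v, Group (G v)] : Type _ :=
  CoprodI G ⧸ Subgroup.normalClosure (graphProdRels Γ G)

instance {V : Type*} (Γ : SimpleGraph V) (G : V → Type*) [∀ v, Group (G v)] :
    Group (GraphProduct Γ G) :=
  QuotientGroup.Quotient.group _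

/-- The canonical map from a vertex group into the graph product. -/
def GraphProduct.of {V : Type*} (Γ : SimpleGraph V) (G : V → Type*) [∀ v, Group (G v)] (v : V) :
    G v →* GraphProduct Γ G :=
  (QuotientGroup.mk' _).comp CoprodI.of

/-- `G(A)`: the subgroup of the graph product generated by the images of the vertex groups
`G_a`, `a ∈ A`. -/
def GraphProduct.vsub {V : Type*} (Γ : SimpleGraph V) (G : V → Type*) [∀ v, Group (G v)]
    (A : Set V) : Subgroup (GraphProduct Γ G) :=
  ⨆ a ∈ A, (GraphProduct.of Γ G a).range

/-- A clique of a graph: a maximal set of pairwise adjacent vertices. -/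
def IsMaxClique {V : Type*} (Γ : SimpleGraph V) (C : Set V) : Prop :=
  Γ.IsClique C ∧ ∀ D : Set V, Γ.IsClique D → C ⊆ D → C = D

namespace AmalgAux

open Monoid PushoutI

variable {ι : Type*} {G : ι → Type*} {B : Type*} [∀ i, Group (G i)] [Group B]
  {φ : ∀ i, B →* G i}

/-- Reduced lists of letters. -/
def Red (φ : ∀ i, B →* G i) (l : List (Σ i, G i)) : Prop :=
  (∀ g ∈ l, g.2 ∉ (φ g.1).range) ∧ l.IsChain (fun a b => a.1 ≠ b.1)

/-- A letter as an element of the amalgam. -/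
def lt (φ : ∀ i, B →* G i) (a : Σ i, G i) : PushoutI φ := of a.1 a.2

/-- The product of a list of letters. -/
def pr (φ : ∀ i, B →* G i) (l : List (Σ i, G i)) : PushoutI φ := (l.map (lt φ)).prod

/-- The reduced list as a word. -/
def Red.toWord {l : List (Σ i, G i)} (h : Red φ l) : CoprodI.Word G where
  toList := l
  ne_one := fun a ha h1 => h.1 a ha (h1 ▸ one_mem _)
  chain_ne := h.2

theorem Red.prod_toWord {l : List (Σ i, G i)} (h : Red φ l) :
    ofCoprodI h.toWord.prod = pr φ l := by
  simp only [CoprodI.Word.prod, map_list_prod, List.map_map, pr, Red.toWord]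
  congr 2

theorem Red.fst_unique (hφ : ∀ i, Function.Injective (φ i)) {l l' : List (Σ i, G i)}
    (h : Red φ l) (h' : Red φ l') (c c' : B)
    (e : base φ c * pr φ l = base φ c' * pr φ l') : l.map Sigma.fst = l'.map Sigma.fst := by
  obtain ⟨d⟩ := NormalWord.transversal_nonempty φ hφ
  obtain ⟨w, hw, hw2⟩ := Reduced.exists_normalWord_prod_eq d (w := h.toWord) h.1
  obtain ⟨w', hw', hw2'⟩ := Reduced.exists_normalWord_prod_eq d (w := h'.toWord) h'.1
  rw [Red.prod_toWord] at hw hw'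
  have : c • w = c' • w' := by
    apply NormalWord.prod_injective
    rw [NormalWord.prod_base_smul, NormalWord.prod_base_smul, hw, hw', e]
  have h3 : (c • w).toList = (c' • w').toList := by rw [this]
  change w.toList = w'.toList at h3
  have h4 : l.map Sigma.fst = w.toList.map Sigma.fst := hw2.symm
  rw [h4, h3]
  exact hw2'

theorem exists_red (hφ : ∀ i, Function.Injective (φ i)) (g : PushoutI φ) :
    ∃ (c : B) (l : List (Σ i, G i)), Red φ l ∧ g = base φ c * pr φ l := by
  classical
  obtain ⟨d⟩ := NormalWord.transversal_nonempty φ hφ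
  obtain ⟨w, rfl⟩ := (NormalWord.equiv (d := d)).symm.surjective g
  have hr : Red φ w.toList := by
    refine ⟨fun a ha hr => ?_, w.chain_ne⟩
    have h1 := w.ne_one a ha
    have h2 := w.normalized a.1 a.2 ha
    have := (d.compl a.1).1 (a₁ := (⟨a.2, hr⟩, ⟨1, d.one_mem _⟩))
      (a₂ := (⟨1, one_mem _⟩, ⟨a.2, h2⟩)) (by simp)
    simp only [Prod.mk.injEq, Subtype.mk.injEq] at this
    exact h1 this.1
  refine ⟨w.head, w.toList, hr, ?_⟩
  rw [← hr.prod_toWord]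
  rfl

/-- `g` has a reduced expression of length `n`. -/
def HasLen (g : PushoutI φ) (n : ℕ) : Prop :=
  ∃ (c : B) (l : List (Σ i, G i)), Red φ l ∧ g = base φ c * pr φ l ∧ l.length = n

theorem HasLen.unique (hφ : ∀ i, Function.Injective (φ i)) {g : PushoutI φ} {m n : ℕ}
    (hm : HasLen g m) (hn : HasLen g n) : m = n := by
  obtain ⟨c, l, hl, rfl, rfl⟩ := hm
  obtain ⟨c', l', hl', e, rfl⟩ := hn
  simpa using congrArg List.length (hl.fst_unique hφ hl' c c' e)

theorem HasLen.exists (hφ : ∀ i, Function.Injective (φ i)) (g : PushoutI φ) :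
    ∃ n, HasLen g n := by
  obtain ⟨c, l, hl, e⟩ := exists_red hφ g
  exact ⟨_, c, l, hl, e, rfl⟩

@[simp] theorem pr_nil : pr φ [] = 1 := rfl
@[simp] theorem pr_cons (a : Σ i, G i) (l) : pr φ (a :: l) = lt φ a * pr φ l := by simp [pr]
@[simp] theorem pr_append (l l' : List (Σ i, G i)) : pr φ (l ++ l') = pr φ l * pr φ l' := by
  simp [pr]

theorem Red.hasLen {l : List (Σ i, G i)} (h : Red φ l) : HasLen (pr φ l) l.length :=
  ⟨1, l, h, by simp, rfl⟩

theorem base_mul_lt (c : B) (i) (x : G i) : base φ c * lt φ ⟨i, x⟩ = lt φ ⟨i, φ i c * x⟩ := by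
  simp [lt, of_apply_eq_base]

theorem lt_mul_base (c : B) (i) (x : G i) : lt φ ⟨i, x⟩ * base φ c = lt φ ⟨i, x * φ i c⟩ := by
  simp [lt, of_apply_eq_base]

theorem red_append {l l' : List (Σ i, G i)} : Red φ (l ++ l') ↔ Red φ l ∧ Red φ l' ∧
    ∀ x ∈ l.getLast?, ∀ y ∈ l'.head?, x.1 ≠ y.1 := by
  simp only [Red, List.mem_append, List.isChain_append]
  constructor
  · rintro ⟨h1, h2, h3, h4⟩
    exact ⟨⟨fun g hg => h1 g (Or.inl hg), h2⟩, ⟨fun g hg => h1 g (Or.inr hg), h3⟩, h4⟩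
  · rintro ⟨⟨h1, h2⟩, ⟨h3, h4⟩, h5⟩
    exact ⟨fun g hg => hg.elim (h1 g) (h3 g), h2, h4, h5⟩

theorem red_cons {a : Σ i, G i} {l' : List (Σ i, G i)} : Red φ (a :: l') ↔
    a.2 ∉ (φ a.1).range ∧ Red φ l' ∧ ∀ y ∈ l'.head?, a.1 ≠ y.1 := by
  simp only [Red, List.mem_cons, List.isChain_cons, forall_eq_or_imp]
  tauto

theorem red_nil : Red φ [] := by simp [Red]

/-- length at least one: absorb the base element -/
theorem HasLen.exists_list {g : PushoutI φ} {n : ℕ} (h : HasLen g (n + 1)) :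
    ∃ l, Red φ l ∧ g = pr φ l ∧ l.length = n + 1 := by
  obtain ⟨c, l, hl, rfl, hn⟩ := h
  match l, hn with
  | ⟨i, x⟩ :: t, hn =>
    refine ⟨⟨i, φ i c * x⟩ :: t, ?_, ?_, by simpa using hn⟩
    · rw [red_cons] at hl ⊢
      refine ⟨?_, hl.2⟩
      rw [Subgroup.mul_mem_cancel_left _ (by simp)]
      exact hl.1
    · rw [pr_cons, pr_cons, ← mul_assoc, base_mul_lt]

theorem HasLen.base_mul {g : PushoutI φ} {n : ℕ} (c : B) (h : HasLen g n) :
    HasLen (base φ c * g) n := by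
  obtain ⟨c', l, hl, rfl, hn⟩ := h
  exact ⟨c * c', l, hl, by simp [mul_assoc], hn⟩

theorem HasLen.mul_base {g : PushoutI φ} {n : ℕ} (c : B) (h : HasLen g n) :
    HasLen (g * base φ c) n := by
  obtain ⟨c', l, hl, rfl, hn⟩ := h
  rw [mul_assoc]
  apply HasLen.base_mul
  rcases List.eq_nil_or_concat l with rfl | ⟨s, ⟨i, x⟩, rfl⟩
  · exact ⟨c, [], red_nil, by simp, hn⟩
  · refine ⟨1, s ++ [⟨i, x * φ i c⟩], ?_, ?_, by simpa using hn⟩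
    · rw [List.concat_eq_append, red_append] at hl
      rw [red_append]
      refine ⟨hl.1, ?_, ?_⟩
      · have := hl.2.1
        rw [red_cons] at this ⊢
        refine ⟨?_, this.2⟩
        rw [Subgroup.mul_mem_cancel_right _ (by simp)]
        exact this.1
      · simpa using hl.2.2
    · simp [mul_assoc, lt_mul_base]

theorem hasLen_of (i) (x : G i) : ∃ n ≤ 1, HasLen (of i x : PushoutI φ) n := by
  by_cases hx : x ∈ (φ i).range
  · obtain ⟨c, rfl⟩ := hx
    exact ⟨0, by simp, c, [], red_nil, by simp [of_apply_eq_base], rfl⟩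
  · exact ⟨1, le_rfl, 1, [⟨i, x⟩], red_cons.2 ⟨hx, red_nil, by simp⟩, by simp [lt], rfl⟩

/-- If a product of two reduced lists is much shorter than expected then there is cancellation. -/
theorem cancel {s t : List (Σ i, G i)} {b a : Σ i, G i}
    (hs : Red φ (s ++ [b])) (ht : Red φ (a :: t)) :
    (lt φ b * lt φ a ∈ (base φ).range) ∨
      (a.1 = b.1 ∧ HasLen (pr φ (s ++ [b]) * pr φ (a :: t)) (s.length + 1 + t.length)) ∨
      HasLen (pr φ (s ++ [b]) * pr φ (a :: t)) (s.length + 1 + (t.length + 1)) := by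
  obtain ⟨i, x⟩ := b
  obtain ⟨j, y⟩ := a
  by_cases hij : i = j
  · subst hij
    by_cases hxy : x * y ∈ (φ i).range
    · left
      obtain ⟨c, hc⟩ := hxy
      exact ⟨c, by rw [← of_apply_eq_base φ i, hc]; simp [lt]⟩
    · right; left
      refine ⟨rfl, 1, s ++ (⟨i, x * y⟩ :: t), ?_, ?_, by simp; omega⟩
      · rw [red_append] at hs ⊢
        rw [red_cons] at ht ⊢
        refine ⟨hs.1, ⟨hxy, ht.2⟩, ?_⟩
        simpa using hs.2.2
      · simp [lt, mul_assoc]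
  · right; right
    refine ⟨1, (s ++ [⟨i, x⟩]) ++ (⟨j, y⟩ :: t), ?_, ?_, by simp; omega⟩
    · rw [red_append]
      refine ⟨hs, ht, ?_⟩
      simpa using hij
    · rw [pr_append]; simp [mul_assoc]

theorem exists_mid {l : List (Σ i, G i)} {n : ℕ} (h : l.length = n + 2) :
    ∃ a m b, l = a :: (m ++ [b]) ∧ m.length = n := by
  match l, h with
  | a :: t, h =>
    rcases List.eq_nil_or_concat t with rfl | ⟨m, b, rfl⟩
    · simp at h
    · exact ⟨a, m, b, by simp, by simpa using h⟩

theorem bounded_step (hφ : ∀ i, Function.Injective (φ i)) (H : Subgroup (PushoutI φ)) (n : ℕ)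
    (hH : ∀ h ∈ H, ∃ k ≤ n + 2, HasLen h k) :
    ∃ g : PushoutI φ, ∀ h ∈ H, ∃ k ≤ n + 1, HasLen (g⁻¹ * h * g) k := by
  by_cases hmax : ∃ h ∈ H, HasLen h (n + 2)
  swap
  · refine ⟨1, fun h hh => ?_⟩
    obtain ⟨k, hk, hl⟩ := hH h hh
    refine ⟨k, ?_, by simpa using hl⟩
    by_contra hlt
    have : k = n + 2 := by omega
    subst this
    exact hmax ⟨h, hh, hl⟩
  obtain ⟨h, hh, hlen⟩ := hmax
  obtain ⟨l, hl, rfl, hlen'⟩ := hlen.exists_list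
  obtain ⟨a, m, b, rfl, hm⟩ := exists_mid hlen'
  have hle : ∀ g ∈ H, ∀ k, HasLen g k → k ≤ n + 2 := by
    intro g hg k hk
    obtain ⟨k', hk', h'⟩ := hH g hg
    rwa [hk.unique hφ h']
  have hba : lt φ b * lt φ a ∈ (base φ).range := by
    have e : a :: (m ++ [b]) = (a :: m) ++ [b] := rfl
    have hmul := H.mul_mem hh hh
    rcases cancel (e ▸ hl) hl with h1 | h1 | h1
    · exact h1
    · have := hle _ hmul _ h1.2
      simp at this; omega
    · have := hle _ hmul _ h1
      simp at this; omega
  refine ⟨lt φ a, fun k hk => ?_⟩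
  obtain ⟨r, hr, hkr⟩ := hH k hk
  match r, hr, hkr with
  | 0, hr, hkr =>
    obtain ⟨c, l, -, rfl, h0⟩ := hkr
    obtain rfl := List.length_eq_zero_iff.1 h0
    obtain ⟨q, hq, hq'⟩ := hasLen_of (φ := φ) a.1 (a.2⁻¹ * φ a.1 c * a.2)
    refine ⟨q, by omega, ?_⟩
    simpa [lt, of_apply_eq_base] using hq'
  | 1, hr, hkr =>
    obtain ⟨l, hl1, rfl, h1⟩ := hkr.exists_list
    obtain ⟨⟨j, y⟩, rfl⟩ := List.length_eq_one_iff.1 h1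
    by_cases hj : j = a.1
    · subst hj
      obtain ⟨q, hq, hq'⟩ := hasLen_of (φ := φ) a.1 (a.2⁻¹ * y * a.2)
      refine ⟨q, by omega, ?_⟩
      simpa [lt] using hq'
    · exfalso
      have hR : Red φ ([⟨j, y⟩] ++ (a :: (m ++ [b]))) := by
        rw [red_append]
        exact ⟨hl1, hl, by simpa using hj⟩
      have := hR.hasLen
      rw [pr_append] at this
      have := hle _ (H.mul_mem hk hh) _ this
      simp at this; omega
  | r + 2, hr, hkr =>
    obtain ⟨l', hl', rfl, hlr⟩ := hkr.exists_list
    obtain ⟨a', m', b', rfl, hm'⟩ := exists_mid hlr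
    have e : a :: (m ++ [b]) = (a :: m) ++ [b] := rfl
    have e' : a' :: (m' ++ [b']) = (a' :: m') ++ [b'] := rfl
    have h1 : lt φ b * lt φ a' ∈ (base φ).range := by
      have hmul := H.mul_mem hh hk
      rcases cancel (e ▸ hl) hl' with h1 | h1 | h1
      · exact h1
      · have := hle _ hmul _ h1.2
        simp at this; omega
      · have := hle _ hmul _ h1
        simp at this; omega
    have h2 : lt φ b' * lt φ a ∈ (base φ).range := by
      have hmul := H.mul_mem hk hh
      rcases cancel (e' ▸ hl') hl with h1 | h1 | h1
      · exact h1
      · have := hle _ hmul _ h1.2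
        simp at this; omega
      · have := hle _ hmul _ h1
        simp at this; omega
    have h3 : (lt φ a)⁻¹ * lt φ a' ∈ (base φ).range := by
      have := mul_mem (inv_mem hba) h1
      simpa [mul_assoc] using this
    obtain ⟨c, hc⟩ := h3
    obtain ⟨c', hc'⟩ := h2
    have hmred : Red φ m' := (red_append.1 (red_cons.1 hl').2.1).1
    refine ⟨r, by omega, ?_⟩
    have := (hmred.hasLen.base_mul c).mul_base c'
    rw [hc, hc', hm'] at this
    simpa [mul_assoc] using this

theorem bounded_one [Nonempty ι] (hφ : ∀ i, Function.Injective (φ i)) (H : Subgroup (PushoutI φ))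
    (hH : ∀ h ∈ H, ∃ k ≤ 1, HasLen h k) : ∃ i, H ≤ (of i : G i →* PushoutI φ).range := by
  have key : ∀ h ∈ H, h ∈ (base φ).range ∨ ∃ a : Σ i, G i, Red φ [a] ∧ h = lt φ a := by
    intro h hh
    obtain ⟨k, hk, hl⟩ := hH h hh
    match k, hk, hl with
    | 0, _, hl =>
      obtain ⟨c, l, -, rfl, h0⟩ := hl
      obtain rfl := List.length_eq_zero_iff.1 h0
      left; exact ⟨c, by simp⟩
    | 1, _, hl =>
      obtain ⟨l, hl1, rfl, h1⟩ := hl.exists_list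
      obtain ⟨a, rfl⟩ := List.length_eq_one_iff.1 h1
      right; exact ⟨a, hl1, by simp⟩
  have hb : ∀ i, (base φ).range ≤ (of i : G i →* PushoutI φ).range := by
    rintro i _ ⟨c, rfl⟩
    exact ⟨φ i c, of_apply_eq_base φ i c⟩
  by_cases hex : ∃ h ∈ H, ∃ a : Σ i, G i, Red φ [a] ∧ h = lt φ a
  · obtain ⟨h, hh, a, ha, rfl⟩ := hex
    refine ⟨a.1, fun k hk => ?_⟩
    rcases key k hk with h1 | ⟨a', ha', rfl⟩
    · exact hb _ h1
    · by_cases e : a'.1 = a.1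
      · obtain ⟨j, y⟩ := a'
        obtain ⟨i, x⟩ := a
        simp only at e
        subst e
        exact ⟨y, rfl⟩
      · exfalso
        have hR : Red φ ([a'] ++ [a]) := red_append.2 ⟨ha', ha, by simpa using e⟩
        have h2 := hR.hasLen
        obtain ⟨k, hk1, hk2⟩ := hH _ (H.mul_mem hk hh)
        simp only [pr_append, pr_cons, pr_nil, mul_one] at h2
        have := hk2.unique hφ h2
        simp at this; omega
  · refine ⟨Classical.arbitrary ι, fun k hk => ?_⟩
    rcases key k hk with h1 | h1
    · exact hb _ h1
    · exact absurd ⟨k, hk, h1⟩ hex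

theorem bounded [Nonempty ι] (hφ : ∀ i, Function.Injective (φ i)) (n : ℕ) :
    ∀ (H : Subgroup (PushoutI φ)), (∀ h ∈ H, ∃ k ≤ n + 1, HasLen h k) →
    ∃ i, ∃ g : PushoutI φ, ∀ h ∈ H, g⁻¹ * h * g ∈ (of i : G i →* PushoutI φ).range := by
  induction n with
  | zero =>
    intro H hH
    obtain ⟨i, hi⟩ := bounded_one hφ H hH
    exact ⟨i, 1, fun h hh => by simpa using hi hh⟩
  | succ n ih =>
    intro H hH
    obtain ⟨g, hg⟩ := bounded_step hφ H n hH
    obtain ⟨i, g', hg'⟩ := ih (H.map (MulAut.conj g⁻¹).toMonoidHom) (by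
      rintro _ ⟨h, hh, rfl⟩
      simpa using hg h hh)
    refine ⟨i, g * g', fun h hh => ?_⟩
    have := hg' _ ⟨h, hh, rfl⟩
    simpa [mul_assoc] using this

/-- A finite subgroup of an amalgam is conjugate into a factor. -/
theorem finite_conj [Nonempty ι] (hφ : ∀ i, Function.Injective (φ i))
    (H : Subgroup (PushoutI φ)) [Finite H] :
    ∃ i, ∃ g : PushoutI φ, ∀ h ∈ H, g⁻¹ * h * g ∈ (of i : G i →* PushoutI φ).range := by
  choose f hf using HasLen.exists hφ
  obtain ⟨N, hN⟩ := (Set.finite_range (fun h : H => f h)).bddAbove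
  refine bounded hφ N H fun h hh => ⟨f h, ?_, hf h⟩
  have : f h ≤ N := hN ⟨⟨h, hh⟩, rfl⟩
  omega

end AmalgAux

namespace GPAux

open Monoid GraphProduct

variable {V : Type*} {Γ : SimpleGraph V} {G : V → Type*} [∀ v, Group (G v)]

/-- Universal property of the graph product. -/
def glift {K : Type*} [Group K] (f : ∀ v, G v →* K)
    (hf : ∀ u v, Γ.Adj u v → ∀ g h, Commute (f u g) (f v h)) : GraphProduct Γ G →* K :=
  QuotientGroup.lift _ (CoprodI.lift f) (by
    refine Subgroup.normalClosure_le_normal (N := (CoprodI.lift f).ker) ?_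
    rintro _ ⟨u, v, huv, g, h, rfl⟩
    have := (hf u v huv g h).eq
    simp only [SetLike.mem_coe, MonoidHom.mem_ker, map_mul, map_inv, CoprodI.lift_of]
    rw [mul_assoc, this]
    group)

theorem glift_of {K : Type*} [Group K] (f : ∀ v, G v →* K)
    (hf : ∀ u v, Γ.Adj u v → ∀ g h, Commute (f u g) (f v h)) (v : V) (g : G v) :
    glift f hf (GraphProduct.of Γ G v g) = f v g := by
  change CoprodI.lift f (CoprodI.of g) = _
  simp

theorem of_commute {u v : V} (h : Γ.Adj u v) (a : G u) (b : G v) :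
    Commute (GraphProduct.of Γ G u a) (GraphProduct.of Γ G v b) := by
  have h1 : (CoprodI.of a)⁻¹ * (CoprodI.of b)⁻¹ * CoprodI.of a * CoprodI.of b ∈
      Subgroup.normalClosure (graphProdRels Γ G) :=
    Subgroup.subset_normalClosure ⟨u, v, h, a, b, rfl⟩
  have h2 : (GraphProduct.of Γ G u a)⁻¹ * (GraphProduct.of Γ G v b)⁻¹ *
      GraphProduct.of Γ G u a * GraphProduct.of Γ G v b = 1 :=
    (QuotientGroup.eq_one_iff _).2 h1
  have h3 : (GraphProduct.of Γ G v b * GraphProduct.of Γ G u a)⁻¹ *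
      (GraphProduct.of Γ G u a * GraphProduct.of Γ G v b) = 1 := by
    rw [← h2]; group
  exact (inv_mul_eq_one.1 h3).symm

theorem of_mem_vsub {A : Set V} {v : V} (hv : v ∈ A) (g : G v) :
    GraphProduct.of Γ G v g ∈ vsub Γ G A :=
  (le_iSup₂ (f := fun a (_ : a ∈ A) => (GraphProduct.of Γ G a).range) v hv) ⟨g, rfl⟩

theorem vsub_le {A : Set V} {K : Subgroup (GraphProduct Γ G)}
    (h : ∀ v ∈ A, ∀ g : G v, GraphProduct.of Γ G v g ∈ K) : vsub Γ G A ≤ K := by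
  refine iSup₂_le fun v hv => ?_
  rintro _ ⟨g, rfl⟩
  exact h v hv g

theorem vsub_mono {A B : Set V} (h : A ⊆ B) : vsub Γ G A ≤ vsub Γ G B :=
  vsub_le fun _ hv g => of_mem_vsub (h hv) g

theorem vsub_univ : vsub Γ G Set.univ = ⊤ := by
  rw [eq_top_iff]
  rintro x -
  obtain ⟨y, rfl⟩ := QuotientGroup.mk_surjective x
  induction y using CoprodI.induction_on with
  | one => exact one_mem (vsub Γ G Set.univ)
  | of i m => exact of_mem_vsub (Γ := Γ) (Set.mem_univ i) m
  | mul x y hx hy => exact mul_mem (S := Subgroup (GraphProduct Γ G)) hx hy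

theorem exists_toPi : ∃ f : GraphProduct Γ G →* (∀ v, G v), ∀ v g,
    open Classical in f (GraphProduct.of Γ G v g) = Pi.mulSingle v g := by
  classical
  have hc : ∀ u v, Γ.Adj u v → ∀ (g : G u) (h : G v),
      Commute (MonoidHom.mulSingle G u g) (MonoidHom.mulSingle G v h) := by
    intro u v huv g h
    exact Pi.mulSingle_commute huv.ne g h
  refine ⟨glift (fun v => MonoidHom.mulSingle G v) hc, fun v g => ?_⟩
  rw [glift_of]
  simp only [MonoidHom.mulSingle_apply]

theorem subset_of_conj [∀ v, Nontrivial (G v)] {C D : Set V} (g : GraphProduct Γ G)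
    (h : ∀ x ∈ vsub Γ G C, g⁻¹ * x * g ∈ vsub Γ G D) : C ⊆ D := by
  classical
  intro v hv
  by_contra hvD
  obtain ⟨f, hf⟩ := exists_toPi (Γ := Γ) (G := G)
  obtain ⟨a, ha⟩ := exists_ne (1 : G v)
  let p : GraphProduct Γ G →* G v := (Pi.evalMonoidHom G v).comp f
  have h1 : vsub Γ G D ≤ p.ker := by
    refine vsub_le fun w hw b => ?_
    have : v ≠ w := fun e => hvD (e ▸ hw)
    simp only [MonoidHom.mem_ker, p, MonoidHom.comp_apply, hf, Pi.evalMonoidHom_apply]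
    exact Pi.mulSingle_eq_of_ne this _
  have h2 : p (g⁻¹ * GraphProduct.of Γ G v a * g) = 1 := h1 (h _ (of_mem_vsub hv a))
  have h3 : p (GraphProduct.of Γ G v a) = a := by
    simp only [p, MonoidHom.comp_apply, hf, Pi.evalMonoidHom_apply]
    exact Pi.mulSingle_eq_same _ _
  rw [map_mul, map_mul, map_inv, h3] at h2
  apply ha
  have : a = p g * ((p g)⁻¹ * a * p g) * (p g)⁻¹ := by group
  rw [this, h2]; group

theorem finite_vsub [Finite V] [∀ v, Finite (G v)] {C : Set V} (hC : Γ.IsClique C) :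
    Finite (vsub Γ G C) := by
  classical
  cases nonempty_fintype V
  have hcomm : Pairwise fun i j : C => ∀ x y,
      Commute (GraphProduct.of Γ G i x) (GraphProduct.of Γ G j y) := by
    intro i j hij x y
    exact of_commute (hC i.2 j.2 (fun e => hij (Subtype.ext e))) x y
  have h := MonoidHom.noncommPiCoprod_range
    (ϕ := fun i : C => GraphProduct.of Γ G i.1) (hcomm := hcomm)
  have e : vsub Γ G C = ⨆ i : C, (GraphProduct.of Γ G i.1).range := by
    rw [vsub, iSup_subtype]
  rw [e, ← h]
  exact (Set.finite_range (MonoidHom.noncommPiCoprod _ hcomm)).to_subtype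

theorem finite_map {A B : Type*} [Group A] [Group B] (f : A →* B) (H : Subgroup A) [Finite H] :
    Finite (H.map f) :=
  ((Set.toFinite (H : Set A)).image f).to_subtype

theorem step {S : Set V} {u v : V} (huv : u ≠ v) (hna : ¬ Γ.Adj u v)
    (H : Subgroup (GraphProduct Γ G)) [Finite H] (hH : H ≤ vsub Γ G S) :
    ∃ w, (w = u ∨ w = v) ∧ ∃ g : GraphProduct Γ G, ∀ h ∈ H, g⁻¹ * h * g ∈ vsub Γ G (S \ {w}) := by
  classical
  let p : Bool → V := fun b => if b then u else v
  let X : Bool → Set V := fun b => S \ {p b}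
  have hX : ∀ b, S \ {u, v} ⊆ X b := by
    rintro b w ⟨hw, hw'⟩
    refine ⟨hw, fun e => hw' ?_⟩
    have e : w = p b := e
    cases b
    · right; exact e
    · left; exact e
  let φ : ∀ b, vsub Γ G (S \ {u, v}) →* vsub Γ G (X b) := fun b =>
    Subgroup.inclusion (vsub_mono (hX b))
  have hφ : ∀ b, Function.Injective (φ b) := fun b => Subgroup.inclusion_injective _
  let e : ∀ b w, w ∈ X b → (G w →* PushoutI φ) := fun b w hw =>
    (PushoutI.of b).comp ((GraphProduct.of Γ G w).codRestrict (vsub Γ G (X b))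
      (fun g => of_mem_vsub hw g))
  have hee : ∀ w (h1 : w ∈ X true) (h2 : w ∈ X false), e true w h1 = e false w h2 := by
    intro w h1 h2
    have hw : w ∈ S \ {u, v} := ⟨h1.1, by
      rintro (h | h)
      · exact h1.2 h
      · exact h2.2 h⟩
    ext g
    have a1 := PushoutI.of_apply_eq_base φ true ⟨GraphProduct.of Γ G w g, of_mem_vsub hw g⟩
    have a2 := PushoutI.of_apply_eq_base φ false ⟨GraphProduct.of Γ G w g, of_mem_vsub hw g⟩
    exact a1.trans a2.symm
  let F : ∀ w, G w →* PushoutI φ := fun w =>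
    if h : w ∈ X true then e true w h else if h : w ∈ X false then e false w h else 1
  have hF : ∀ b w (h : w ∈ X b), F w = e b w h := by
    intro b w h
    cases b
    · by_cases h1 : w ∈ X true
      · simp only [F, dif_pos h1]; exact hee w h1 h
      · simp only [F, dif_neg h1, dif_pos h]
    · simp only [F, dif_pos h]
  have hF1 : ∀ w, w ∉ S → F w = 1 := by
    intro w hw
    have h1 : w ∉ X true := fun h => hw h.1
    have h2 : w ∉ X false := fun h => hw h.1
    simp only [F, dif_neg h1, dif_neg h2]
  have hcomm : ∀ w w', Γ.Adj w w' → ∀ g h, Commute (F w g) (F w' h) := by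
    intro w w' hww g h
    by_cases hw : w ∈ S
    swap
    · rw [hF1 w hw]; exact Commute.one_left _
    by_cases hw' : w' ∈ S
    swap
    · rw [hF1 w' hw']; exact Commute.one_right _
    have hb : ∃ b, w ∈ X b ∧ w' ∈ X b := by
      by_cases c1 : w = u
      · refine ⟨false, ⟨hw, fun e => huv (c1.symm.trans e)⟩, ⟨hw', fun e => hna ?_⟩⟩
        have e : w' = v := e
        rwa [← c1, ← e]
      · by_cases c2 : w' = u
        · refine ⟨false, ⟨hw, fun e => hna ?_⟩, ⟨hw', fun e => huv (c2.symm.trans e)⟩⟩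
          have e : w = v := e
          rw [← c2, ← e]; exact hww.symm
        · exact ⟨true, ⟨hw, c1⟩, ⟨hw', c2⟩⟩
    obtain ⟨b, h1, h2⟩ := hb
    rw [hF b w h1, hF b w' h2]
    refine Commute.map (f := (PushoutI.of b : _ →* PushoutI φ)) ?_
    exact Subtype.ext (of_commute hww g h).eq
  let Φ : GraphProduct Γ G →* PushoutI φ := glift F hcomm
  let π : PushoutI φ →* GraphProduct Γ G :=
    PushoutI.lift (fun b => (vsub Γ G (X b)).subtype) (vsub Γ G (S \ {u, v})).subtype
      (fun b => Subgroup.subtype_comp_inclusion (vsub_mono (hX b)))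
  have hπ : ∀ x ∈ vsub Γ G S, π (Φ x) = x := by
    have : vsub Γ G S ≤ (π.comp Φ).eqLocus (MonoidHom.id _) := by
      refine vsub_le fun w hw g => ?_
      have hb : ∃ b, w ∈ X b := by
        by_cases c1 : w = u
        · exact ⟨false, hw, fun e => huv (c1.symm.trans e)⟩
        · exact ⟨true, hw, c1⟩
      obtain ⟨b, hb⟩ := hb
      change π (Φ (GraphProduct.of Γ G w g)) = GraphProduct.of Γ G w g
      simp only [Φ, glift_of, hF b w hb]
      exact PushoutI.lift_of _ _ _ _
    exact fun x hx => this hx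
  have := finite_map Φ H
  obtain ⟨b, g, hg⟩ := AmalgAux.finite_conj hφ (H.map Φ)
  refine ⟨p b, ?_, π g, fun h hh => ?_⟩
  · cases b
    · right; rfl
    · left; rfl
  · obtain ⟨y, hy⟩ := hg (Φ h) ⟨h, hh, rfl⟩
    have h1 := congrArg π hy
    rw [map_mul, map_mul, map_inv, hπ h (hH hh)] at h1
    rw [← h1]
    have h2 : π (PushoutI.of b y) = y := PushoutI.lift_of _ _ _ _
    rw [h2]
    exact y.2

theorem finite_conj_clique [Finite V] (n : ℕ) : ∀ (S : Set V), S.ncard = n →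
    ∀ (H : Subgroup (GraphProduct Γ G)) [Finite H], H ≤ vsub Γ G S →
    ∃ C, Γ.IsClique C ∧ ∃ g : GraphProduct Γ G, ∀ h ∈ H, g⁻¹ * h * g ∈ vsub Γ G C := by
  induction n with
  | zero =>
    intro S hS H _ hH
    have : S = ∅ := (Set.ncard_eq_zero (Set.toFinite S)).1 hS
    subst this
    exact ⟨∅, by simp, 1, fun h hh => by simpa using hH hh⟩
  | succ n ih =>
    intro S hS H _ hH
    by_cases hcl : Γ.IsClique S
    · exact ⟨S, hcl, 1, fun h hh => by simpa using hH hh⟩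
    have : ∃ u ∈ S, ∃ v ∈ S, u ≠ v ∧ ¬ Γ.Adj u v := by
      by_contra hcon
      push Not at hcon
      exact hcl fun u hu v hv huv => hcon u hu v hv huv
    obtain ⟨u, hu, v, hv, huv, hna⟩ := this
    obtain ⟨w, hw, g, hg⟩ := step huv hna H hH
    have hwS : w ∈ S := by rcases hw with rfl | rfl <;> assumption
    have hcard : (S \ {w}).ncard = n := by
      rw [Set.ncard_sdiff_singleton_of_mem hwS, hS]; rfl
    have := finite_map (MulAut.conj g⁻¹).toMonoidHom H
    obtain ⟨C, hC, g', hg'⟩ := ih (S \ {w}) hcard (H.map (MulAut.conj g⁻¹).toMonoidHom) (by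
      rintro _ ⟨h, hh, rfl⟩
      simpa using hg h hh)
    refine ⟨C, hC, g * g', fun h hh => ?_⟩
    have := hg' _ ⟨h, hh, rfl⟩
    simpa [mul_assoc] using this

theorem finite_conj_max [Finite V] (H : Subgroup (GraphProduct Γ G)) [Finite H] :
    ∃ C, IsMaxClique Γ C ∧ ∃ g : GraphProduct Γ G,
      H ≤ (vsub Γ G C).map (MulAut.conj g).toMonoidHom := by
  obtain ⟨C, hC, g, hg⟩ := finite_conj_clique (Γ := Γ) (G := G) _ Set.univ rfl H
    (by rw [vsub_univ]; exact le_top)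
  obtain ⟨D, hCD, hD⟩ := (Set.toFinite {D : Set V | Γ.IsClique D}).exists_le_maximal hC
  refine ⟨D, ⟨hD.1, fun E hE hDE => le_antisymm hDE (hD.2 hE hDE)⟩, g, fun h hh => ?_⟩
  refine ⟨g⁻¹ * h * g, vsub_mono hCD (hg h hh), ?_⟩
  simp [mul_assoc]

theorem subset_of_le [∀ v, Nontrivial (G v)] {C D : Set V} (g : GraphProduct Γ G)
    (h : vsub Γ G C ≤ (vsub Γ G D).map (MulAut.conj g).toMonoidHom) : C ⊆ D := by
  refine subset_of_conj g fun x hx => ?_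
  obtain ⟨y, hy, rfl⟩ := h hx
  simpa [mul_assoc] using hy

end GPAux

/-- Let `φ` be an isomorphism between the graph products of `(Γ, G)` and
`(Γ', G')`, where all vertex groups are nontrivial and finite.  Then for each clique `C` of `Γ`
there is a unique clique `C'` of `Γ'` such that `φ(G(C))` is conjugate to `G'(C')`. -/
theorem graphProduct_cliques_correspond {V V' : Type*} [Fintype V] [Fintype V']
    (Γ : SimpleGraph V) (Γ' : SimpleGraph V')
    (G : V → Type*) [∀ v, Group (G v)] [∀ v, Finite (G v)] [∀ v, Nontrivial (G v)]
    (G' : V' → Type*) [∀ v', Group (G' v')] [∀ v', Finite (G' v')] [∀ v', Nontrivial (G' v')]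
    (φ : GraphProduct Γ G ≃* GraphProduct Γ' G')
    (C : Set V) (hC : IsMaxClique Γ C) :
    ∃! C' : Set V', IsMaxClique Γ' C' ∧ ∃ g : GraphProduct Γ' G',
      (GraphProduct.vsub Γ G C).map φ.toMonoidHom =
        (GraphProduct.vsub Γ' G' C').map (MulAut.conj g).toMonoidHom := by
  classical
  have hfin : Finite (GraphProduct.vsub Γ G C) := GPAux.finite_vsub hC.1
  have hfin1 : Finite ((GraphProduct.vsub Γ G C).map φ.toMonoidHom) :=
    Finite.of_equiv _ ((GraphProduct.vsub Γ G C).equivMapOfInjective φ.toMonoidHom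
      φ.injective).toEquiv
  obtain ⟨C', hC', g, hg⟩ := GPAux.finite_conj_max ((GraphProduct.vsub Γ G C).map φ.toMonoidHom)
  refine ⟨C', ⟨hC', g, ?_⟩, ?_⟩
  · skip
    have hfin' : Finite (GraphProduct.vsub Γ' G' C') := GPAux.finite_vsub hC'.1
    set K := (GraphProduct.vsub Γ' G' C').map (MulAut.conj g).toMonoidHom with hK
    have hfinK : Finite K :=
      Finite.of_equiv _ ((GraphProduct.vsub Γ' G' C').equivMapOfInjective
        (MulAut.conj g).toMonoidHom (MulAut.conj g).injective).toEquiv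
    have hfinL : Finite (K.map φ.symm.toMonoidHom) :=
      Finite.of_equiv _ (K.equivMapOfInjective φ.symm.toMonoidHom φ.symm.injective).toEquiv
    obtain ⟨D, hD, k, hk⟩ := GPAux.finite_conj_max (K.map φ.symm.toMonoidHom)
    have hle : GraphProduct.vsub Γ G C ≤ K.map φ.symm.toMonoidHom := by
      intro x hx
      exact ⟨φ x, hg ⟨x, hx, rfl⟩, by simp⟩
    have hCD : C = D := hC.2 D hD.1 (GPAux.subset_of_le k (hle.trans hk))
    subst hCD
    refine Subgroup.eq_of_le_of_card_ge hg ?_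
    have c1 : Nat.card ((GraphProduct.vsub Γ G C).map φ.toMonoidHom) =
        Nat.card (GraphProduct.vsub Γ G C) :=
      Nat.card_congr ((GraphProduct.vsub Γ G C).equivMapOfInjective φ.toMonoidHom
        φ.injective).toEquiv.symm
    have c2 : Nat.card (K.map φ.symm.toMonoidHom) = Nat.card K :=
      Nat.card_congr (K.equivMapOfInjective φ.symm.toMonoidHom φ.symm.injective).toEquiv.symm
    have e3 := ((GraphProduct.vsub Γ G C).equivMapOfInjective
        (MulAut.conj k).toMonoidHom (MulAut.conj k).injective).toEquiv
    have c3 := Nat.card_congr e3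
    have hfin3 : Finite ((GraphProduct.vsub Γ G C).map (MulAut.conj k).toMonoidHom) :=
      Finite.of_equiv _ e3
    rw [c1, ← c2, c3]
    exact Nat.card_le_card_of_injective _ (Subgroup.inclusion_injective hk)
  · rintro E ⟨hE, g', hg'⟩
    refine hE.2 C' hC'.1 ?_
    rw [hg'] at hg
    refine GPAux.subset_of_conj (g'⁻¹ * g) fun x hx => ?_
    obtain ⟨y, hy, hxy⟩ := hg ⟨x, hx, rfl⟩
    have hy' : g * y * g⁻¹ = g' * x * g'⁻¹ := by simpa using hxy
    have : (g'⁻¹ * g)⁻¹ * x * (g'⁻¹ * g) = y := by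
      have : y = g⁻¹ * (g * y * g⁻¹) * g := by group
      rw [this, hy']; group
    rw [this]; exact hy
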